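/- For every finite rooted tree T on n ≥ 1 vertices there exists a path decomposition 𝒫 of T (a partition of the vertex set of T into vertex-disjoint downward paths) such that for every vertex v of T, the number of paths in 𝒫 whose top vertex is v or an ancestor of v is at most ⌊log₂ n⌋ + 1. -/

import Mathlib

/-- In a rooted tree given by a `parent` function, `a` is an ancestor of `b`
(reflexively: every vertex is its own ancestor) if following the parent
pointers from `b` eventually reaches `a`. -/
def IsTAncestor {V : Type*} (parent : V → V) (a b : V) : Prop :=
  Relation.ReflTransGen (fun x y => y = parent x) b a

namespace IsTAncestor

variable {V : Type*} {parent : V → V} {root a b c u v w : V}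

protected theorem refl (parent : V → V) (a : V) : IsTAncestor parent a a :=
  Relation.ReflTransGen.refl

theorem trans (hab : IsTAncestor parent a b) (hbc : IsTAncestor parent b c) :
    IsTAncestor parent a c :=
  Relation.ReflTransGen.trans hbc hab

theorem of_parent (h : IsTAncestor parent a (parent b)) : IsTAncestor parent a b :=
  Relation.ReflTransGen.head rfl h

theorem parent_left (h : IsTAncestor parent a b) : IsTAncestor parent (parent a) b :=
  Relation.ReflTransGen.tail h rfl

theorem eq_or_parent (h : IsTAncestor parent a b) :
    b = a ∨ IsTAncestor parent a (parent b) := by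
  rcases Relation.ReflTransGen.cases_head h with h | ⟨c, rfl, h⟩
  exacts [Or.inl h, Or.inr h]

/-- The ancestors of a vertex form a chain. -/
theorem total (ha : IsTAncestor parent a v) (hb : IsTAncestor parent b v) :
    IsTAncestor parent a b ∨ IsTAncestor parent b a :=
  (Relation.ReflTransGen.total_of_right_unique
    (fun _ _ _ h₁ h₂ => h₁.trans h₂.symm) ha hb).symm

theorem eq_root (hroot : parent root = root) (h : IsTAncestor parent a root) : a = root := by
  induction h with
  | refl => rfl
  | tail _ h ih => rw [h, ih, hroot]

/-- The only vertex lying on a cycle of the parent function is the root. -/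
theorem eq_root_of_parent (hroot : parent root = root) (hv : IsTAncestor parent root v)
    (h : IsTAncestor parent v (parent v)) : v = root := by
  induction hv using Relation.ReflTransGen.head_induction_on with
  | refl => rfl
  | @head a c hac _ ih =>
    subst hac
    have hc : IsTAncestor parent (parent a) (parent (parent a)) := by
      rcases h.eq_or_parent with h' | h'
      · rw [h', h']
        exact .refl parent a
      · exact h'.parent_left
    rw [ih hc] at h
    exact h.eq_root hroot

theorem eq_or_exists_child (hroot : parent root = root) (h : IsTAncestor parent v w) :
    v = w ∨ ∃ c, c ≠ root ∧ parent c = v ∧ IsTAncestor parent c w := by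
  induction h with
  | refl => exact Or.inl rfl
  | @tail b v hb hv ih =>
    by_cases hbr : b = root
    · have : v = b := by rw [hv, hbr, hroot]
      rwa [this]
    · exact Or.inr ⟨b, hbr, hv.symm, hb⟩

/-- Distinct children of a vertex have disjoint subtrees. -/
theorem eq_of_parent_eq (hroot : parent root = root)
    (hspan : ∀ v, IsTAncestor parent root v) (ha : a ≠ root) (hb : b ≠ root)
    (hab : parent a = parent b) (haw : IsTAncestor parent a w) (hbw : IsTAncestor parent b w) :
    a = b := by
  rcases haw.total hbw with h | h
  · rcases h.eq_or_parent with h | h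
    · exact h.symm
    · exact absurd (eq_root_of_parent hroot (hspan a) (hab ▸ h)) ha
  · rcases h.eq_or_parent with h | h
    · exact h
    · exact absurd (eq_root_of_parent hroot (hspan b) (hab ▸ h)) hb

end IsTAncestor

section HeavyPaths

variable {V : Type*} [Fintype V] {parent : V → V} {root a b v w : V}

open Classical in
/-- The set of vertices of the subtree hanging from `v`. -/
noncomputable def subtree (parent : V → V) (v : V) : Finset V :=
  Finset.univ.filter (IsTAncestor parent v)

/-- The binary logarithm of the number of vertices of the subtree hanging from `v`. -/
noncomputable def subtreeRank (parent : V → V) (v : V) : ℕ :=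
  Nat.log 2 (subtree parent v).card

theorem mem_subtree : w ∈ subtree parent v ↔ IsTAncestor parent v w := by
  simp [subtree]

theorem subtree_subset (h : IsTAncestor parent a b) : subtree parent b ⊆ subtree parent a :=
  fun _ hw => mem_subtree.2 (h.trans (mem_subtree.1 hw))

theorem subtreeRank_le (h : IsTAncestor parent a b) :
    subtreeRank parent b ≤ subtreeRank parent a :=
  Nat.log_mono_right (Finset.card_le_card (subtree_subset h))

theorem card_subtree_pos : 0 < (subtree parent v).card :=
  Finset.card_pos.2 ⟨v, mem_subtree.2 (.refl parent v)⟩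

theorem card_subtree_lt (hroot : parent root = root)
    (hspan : ∀ v, IsTAncestor parent root v) (hv : v ≠ root) :
    (subtree parent v).card < (subtree parent (parent v)).card := by
  refine Finset.card_lt_card (Finset.ssubset_iff_of_subset
    (subtree_subset (IsTAncestor.refl parent v).parent_left) |>.2
      ⟨parent v, mem_subtree.2 (.refl parent _), fun h => hv ?_⟩)
  exact IsTAncestor.eq_root_of_parent hroot (hspan v) (mem_subtree.1 h)

/-- At most one child of a vertex has the same rank as that vertex. -/
theorem eq_of_subtreeRank_eq (hroot : parent root = root)
    (hspan : ∀ v, IsTAncestor parent root v) (ha : a ≠ root) (hb : b ≠ root)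
    (hab : parent a = parent b)
    (har : subtreeRank parent a = subtreeRank parent (parent a))
    (hbr : subtreeRank parent b = subtreeRank parent (parent a)) : a = b := by
  classical
  by_contra hne
  have hdisj : Disjoint (subtree parent a) (subtree parent b) :=
    Finset.disjoint_left.2 fun w hwa hwb => hne <|
      IsTAncestor.eq_of_parent_eq hroot hspan ha hb hab (mem_subtree.1 hwa) (mem_subtree.1 hwb)
  have hcard : (subtree parent a).card + (subtree parent b).card
      ≤ (subtree parent (parent a)).card := by
    rw [← Finset.card_union_of_disjoint hdisj]
    refine Finset.card_le_card (Finset.union_subset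
      (subtree_subset (IsTAncestor.refl parent a).parent_left) ?_)
    rw [hab]
    exact subtree_subset (IsTAncestor.refl parent b).parent_left
  have hla : 2 ^ subtreeRank parent a ≤ (subtree parent a).card :=
    Nat.pow_log_le_self 2 card_subtree_pos.ne'
  have hlb : 2 ^ subtreeRank parent b ≤ (subtree parent b).card :=
    Nat.pow_log_le_self 2 card_subtree_pos.ne'
  have hlv : (subtree parent (parent a)).card < 2 ^ (subtreeRank parent (parent a) + 1) :=
    Nat.lt_pow_succ_log_self one_lt_two _
  rw [har] at hla
  rw [hbr] at hlb
  rw [pow_succ] at hlv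
  omega

/-- The descendants of `v` of the same rank as `v` form a downward path with top `v`. -/
theorem exists_path_of_subtreeRank_eq (hroot : parent root = root)
    (hspan : ∀ v, IsTAncestor parent root v) (v : V) :
    ∃ l : List V, l.head? = some v ∧ l.IsChain (fun a b => b ≠ root ∧ parent b = a) ∧
      ∀ w, w ∈ l ↔ IsTAncestor parent v w ∧ subtreeRank parent w = subtreeRank parent v := by
  induction hn : (subtree parent v).card using Nat.strong_induction_on generalizing v with
  | _ n ih =>
    subst hn
    by_cases hc : ∃ c, c ≠ root ∧ parent c = v ∧ subtreeRank parent c = subtreeRank parent v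
    · obtain ⟨c, hcr, rfl, hrank⟩ := hc
      obtain ⟨l, hhead, hchain, hmem⟩ := ih _ (card_subtree_lt hroot hspan hcr) c rfl
      refine ⟨parent c :: l, rfl, ?_, fun w => ?_⟩
      · refine List.isChain_cons.2 ⟨fun y hy => ?_, hchain⟩
        rw [hhead, Option.mem_some_iff] at hy
        subst hy
        exact ⟨hcr, rfl⟩
      · rw [List.mem_cons, hmem, hrank]
        constructor
        · rintro (rfl | ⟨h, hr⟩)
          exacts [⟨.refl parent _, rfl⟩, ⟨h.parent_left, hr⟩]
        · rintro ⟨h, hr⟩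
          rcases h.eq_or_exists_child hroot with h | ⟨d, hdr, hdc, hdw⟩
          · exact Or.inl h.symm
          · have hdv : subtreeRank parent d = subtreeRank parent (parent c) :=
              le_antisymm (hdc ▸ subtreeRank_le (IsTAncestor.refl parent d).parent_left)
                (hr ▸ subtreeRank_le hdw)
            obtain rfl := eq_of_subtreeRank_eq hroot hspan hcr hdr hdc.symm hrank hdv
            exact Or.inr ⟨hdw, hr⟩
    · refine ⟨[v], rfl, List.isChain_singleton v, fun w => ?_⟩
      rw [List.mem_singleton]
      constructor
      · rintro rfl
        exact ⟨.refl parent _, rfl⟩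
      · rintro ⟨h, hr⟩
        rcases h.eq_or_exists_child hroot with h | ⟨d, hdr, hdc, hdw⟩
        · exact h.symm
        · exact absurd ⟨d, hdr, hdc,
            le_antisymm (hdc ▸ subtreeRank_le (IsTAncestor.refl parent d).parent_left)
              (hr ▸ subtreeRank_le hdw)⟩ hc

/-- A vertex is a heavy top if it is the root or its rank differs from that of its parent. -/
def IsHeavyTop (parent : V → V) (root v : V) : Prop :=
  v = root ∨ subtreeRank parent (parent v) ≠ subtreeRank parent v

theorem exists_isHeavyTop (hv : IsTAncestor parent root v) :
    ∃ t, IsHeavyTop parent root t ∧ IsTAncestor parent t v ∧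
      subtreeRank parent v = subtreeRank parent t := by
  induction hv using Relation.ReflTransGen.head_induction_on with
  | refl => exact ⟨root, Or.inl rfl, .refl parent _, rfl⟩
  | @head a c hac _ ih =>
    subst hac
    obtain ⟨t, ht, hta, hr⟩ := ih
    by_cases h : subtreeRank parent (parent a) = subtreeRank parent a
    · exact ⟨t, ht, hta.of_parent, h ▸ hr⟩
    · exact ⟨a, Or.inr h, .refl parent _, rfl⟩

theorem IsHeavyTop.eq_of_isTAncestor (hroot : parent root = root)
    (hb : IsHeavyTop parent root b) (hab : IsTAncestor parent a b)
    (hr : subtreeRank parent a = subtreeRank parent b) : a = b := by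
  rcases hb with rfl | hb
  · exact hab.eq_root hroot
  · rcases hab.eq_or_parent with h | h
    · exact h.symm
    · exact absurd (le_antisymm (hr ▸ subtreeRank_le h)
        (subtreeRank_le (IsTAncestor.refl parent b).parent_left)) hb

/-- Distinct heavy tops above a given vertex have distinct ranks. -/
theorem IsHeavyTop.eq_of_subtreeRank_eq (hroot : parent root = root)
    (ha : IsHeavyTop parent root a) (hb : IsHeavyTop parent root b)
    (hav : IsTAncestor parent a v) (hbv : IsTAncestor parent b v)
    (hr : subtreeRank parent a = subtreeRank parent b) : a = b := by
  rcases hav.total hbv with h | h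
  · exact hb.eq_of_isTAncestor hroot h hr
  · exact (ha.eq_of_isTAncestor hroot h hr.symm).symm

theorem ncard_heavyTop_ancestors_le (hroot : parent root = root) (v : V) :
    {t | IsHeavyTop parent root t ∧ IsTAncestor parent t v}.ncard
      ≤ Nat.log 2 (Fintype.card V) + 1 := by
  have h := Set.ncard_le_ncard_of_injOn
    (s := {t | IsHeavyTop parent root t ∧ IsTAncestor parent t v})
    (t := (Finset.range (Nat.log 2 (Fintype.card V) + 1) : Set ℕ)) (subtreeRank parent)
    (fun t _ => Finset.mem_coe.2 <| Finset.mem_range.2 <| Nat.lt_succ_of_le <|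
      Nat.log_mono_right (Finset.card_le_univ _))
    (fun a ha b hb hr => ha.1.eq_of_subtreeRank_eq hroot hb.1 ha.2 hb.2 hr)
    (Finset.finite_toSet _)
  rwa [Set.ncard_coe_finset, Finset.card_range] at h

end HeavyPaths

/-- heavy path decomposition of Sleator and Tarjan, Lemma 4 of
the paper. For every finite rooted tree `T` on `n ≥ 1` vertices there is a
partition `Paths` of the vertex set into vertex-disjoint downward paths (each path
is a nonempty list in which each vertex after the first is a child of its
predecessor) such that for every vertex `v`, the number of paths of `Paths` whose
top vertex is `v` or an ancestor of `v` is at most `⌊log₂ n⌋ + 1`. -/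
theorem exists_heavy_path_decomposition {V : Type*} [Fintype V] [DecidableEq V]
    (parent : V → V) (root : V)
    (hroot : parent root = root)
    (hspan : ∀ v : V, IsTAncestor parent root v) :
    ∃ Paths : Finset (List V),
      (∀ p ∈ Paths, p ≠ [] ∧ p.Chain' (fun a b => b ≠ root ∧ parent b = a)) ∧
      (∀ v : V, ∃! p, p ∈ Paths ∧ v ∈ p) ∧
      (∀ v : V,
        Set.ncard {p ∈ (Paths : Set (List V)) |
            ∃ a, p.head? = some a ∧ IsTAncestor parent a v}
          ≤ Nat.log 2 (Fintype.card V) + 1) := by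
  classical
  choose L hhead hchain hmem using exists_path_of_subtreeRank_eq hroot hspan
  refine ⟨(Finset.univ.filter (IsHeavyTop parent root)).image L, fun p hp => ?_,
    fun v => ?_, fun v => ?_⟩
  · obtain ⟨t, -, rfl⟩ := Finset.mem_image.1 hp
    exact ⟨fun h => by simpa [h] using hhead t, hchain t⟩
  · obtain ⟨t, ht, htv, hr⟩ := exists_isHeavyTop (hspan v)
    refine ⟨L t, ⟨Finset.mem_image_of_mem L (by simpa using ht), (hmem t v).2 ⟨htv, hr⟩⟩, ?_⟩
    rintro p ⟨hp, hvp⟩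
    obtain ⟨s, hs, rfl⟩ := Finset.mem_image.1 hp
    obtain ⟨hsv, hsr⟩ := (hmem s v).1 hvp
    rw [IsHeavyTop.eq_of_subtreeRank_eq hroot (Finset.mem_filter.1 hs).2 ht hsv htv
      (hsr.symm.trans hr)]
  · refine le_trans (Set.ncard_le_ncard (t := L '' {t | IsHeavyTop parent root t ∧
      IsTAncestor parent t v}) ?_ (Set.toFinite _)) ((Set.ncard_image_le (Set.toFinite _)).trans
        (ncard_heavyTop_ancestors_le hroot v))
    rintro p ⟨hp, a, ha, hav⟩
    obtain ⟨t, ht, rfl⟩ := Finset.mem_image.1 (Finset.mem_coe.1 hp)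
    obtain rfl : t = a := Option.some.inj ((hhead t).symm.trans ha)
    exact ⟨t, ⟨(Finset.mem_filter.1 ht).2, hav⟩, rfl⟩
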